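/- Let p, q ∈ D with deg q ≥ deg p. Suppose that p(z) > 0 for every real root z of q, or that p(z) < 0 for every real root z of q. Then the matrix [[p, q], [0, 0]] ∈ M₂(D) is a product of idempotent matrices over D. -/

import Mathlib

/-- The minimal Dress ring of `ℝ(X)`: the smallest subring of `RatFunc ℝ` containing
every element of the form `1/(1+x²)`. -/
noncomputable def DressD : Subring (RatFunc ℝ) :=
  Subring.closure {z : RatFunc ℝ | ∃ x : RatFunc ℝ, z = (1 + x ^ 2)⁻¹}

/-- Evaluation at a real number of an element of the Dress ring. -/
noncomputable def evalD (p : DressD) (u : ℝ) : ℝ :=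
  RatFunc.eval (RingHom.id ℝ) u (p : RatFunc ℝ)

/-- A `2 × 2` matrix is a product of idempotent matrices if it is the product of a
finite list of idempotent matrices. -/
def IsProductOfIdempotents {R : Type*} [CommRing R] (A : Matrix (Fin 2) (Fin 2) R) : Prop :=
  ∃ L : List (Matrix (Fin 2) (Fin 2) R), (∀ T ∈ L, IsIdempotentElem T) ∧ L.prod = A

open Polynomial in
theorem Polynomial.eval_sq_add_sq_ne_zero {a b : ℝ[X]} (hab : IsCoprime a b) (u : ℝ) :
    (a ^ 2 + b ^ 2).eval u ≠ 0 := by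
  obtain ⟨r, s, hrs⟩ := hab
  intro h
  rw [eval_add, eval_pow, eval_pow] at h
  have ha : a.eval u = 0 := by nlinarith [sq_nonneg (a.eval u), sq_nonneg (b.eval u)]
  have hb : b.eval u = 0 := by nlinarith [sq_nonneg (a.eval u), sq_nonneg (b.eval u)]
  have := congrArg (eval u) hrs
  simp [ha, hb] at this

open Polynomial in
theorem Polynomial.natDegree_sq_le_natDegree_sq_add_sq (a b : ℝ[X]) :
    (b ^ 2).natDegree ≤ (a ^ 2 + b ^ 2).natDegree := by
  by_cases hb : b = 0
  · simp [hb]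
  have hb' : 0 < b.leadingCoeff ^ 2 := by
    have := leadingCoeff_ne_zero.mpr hb
    positivity
  rcases lt_or_ge b.natDegree a.natDegree with h | h
  · have h2 : (b ^ 2).natDegree < (a ^ 2).natDegree := by
      rw [natDegree_pow, natDegree_pow]; omega
    rw [natDegree_add_eq_left_of_natDegree_lt h2]
    exact h2.le
  · apply le_natDegree_of_ne_zero
    rw [natDegree_pow, coeff_add, coeff_pow_of_natDegree_le le_rfl,
      coeff_pow_of_natDegree_le h]
    change 0 < (b.coeff b.natDegree) ^ 2 at hb'
    nlinarith [sq_nonneg (a.coeff b.natDegree)]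

open Polynomial in
/-- Every element of the Dress ring is a fraction of polynomials, of nonpositive degree,
whose denominator has no real root. -/
theorem DressD.exists_eq_div {z : RatFunc ℝ} (hz : z ∈ DressD) :
    ∃ f γ : ℝ[X], (∀ u, γ.eval u ≠ 0) ∧ f.natDegree ≤ γ.natDegree ∧
      z = algebraMap ℝ[X] (RatFunc ℝ) f / algebraMap ℝ[X] (RatFunc ℝ) γ := by
  have nz : ∀ {γ : ℝ[X]}, (∀ u, γ.eval u ≠ 0) → γ ≠ 0 := by
    rintro γ h rfl
    exact h 0 (by simp)
  have anz : ∀ {γ : ℝ[X]}, (∀ u, γ.eval u ≠ 0) → algebraMap ℝ[X] (RatFunc ℝ) γ ≠ 0 :=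
    fun h => RatFunc.algebraMap_ne_zero (nz h)
  induction hz using Subring.closure_induction with
  | mem z hz =>
    obtain ⟨x, rfl⟩ := hz
    have hγ := eval_sq_add_sq_ne_zero (RatFunc.isCoprime_num_denom x)
    refine ⟨x.denom ^ 2, x.num ^ 2 + x.denom ^ 2, hγ,
      natDegree_sq_le_natDegree_sq_add_sq _ _, ?_⟩
    have h1 : algebraMap ℝ[X] (RatFunc ℝ) x.denom ≠ 0 :=
      RatFunc.algebraMap_ne_zero x.denom_ne_zero
    have h2 := anz hγ
    conv_lhs => rw [← RatFunc.num_div_denom x]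
    rw [map_add, map_pow, map_pow] at h2 ⊢
    rw [div_pow, ← div_self (pow_ne_zero 2 h1), ← add_div, inv_div, add_comm]
  | zero => exact ⟨0, 1, by simp, by simp, by simp⟩
  | one => exact ⟨1, 1, by simp, by simp, by simp⟩
  | add x y _ _ hx hy =>
    obtain ⟨f, γ, hγ, hd, rfl⟩ := hx
    obtain ⟨g, δ, hδ, he, rfl⟩ := hy
    refine ⟨f * δ + γ * g, γ * δ, fun u => by simp [hγ u, hδ u], ?_, ?_⟩
    · rw [natDegree_mul (nz hγ) (nz hδ)]
      refine (natDegree_add_le _ _).trans (max_le ?_ ?_)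
      · exact natDegree_mul_le.trans (by omega)
      · exact natDegree_mul_le.trans (by omega)
    · simp only [map_add, map_mul]
      rw [div_add_div _ _ (anz hγ) (anz hδ)]
  | neg x _ hx =>
    obtain ⟨f, γ, hγ, hd, rfl⟩ := hx
    exact ⟨-f, γ, hγ, by simpa using hd, by rw [map_neg, neg_div]⟩
  | mul x y _ _ hx hy =>
    obtain ⟨f, γ, hγ, hd, rfl⟩ := hx
    obtain ⟨g, δ, hδ, he, rfl⟩ := hy
    refine ⟨f * g, γ * δ, fun u => by simp [hγ u, hδ u], ?_, ?_⟩
    · rw [natDegree_mul (nz hγ) (nz hδ)]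
      exact natDegree_mul_le.trans (by omega)
    · simp only [map_mul]
      rw [div_mul_div_comm]

theorem DressD.inv_one_add_sq_mem (x : RatFunc ℝ) : (1 + x ^ 2)⁻¹ ∈ DressD :=
  Subring.subset_closure ⟨x, rfl⟩

theorem RatFunc.one_add_sq_ne_zero (x : RatFunc ℝ) : 1 + x ^ 2 ≠ 0 := by
  intro h
  have h1 : algebraMap (Polynomial ℝ) (RatFunc ℝ) x.denom ≠ 0 :=
    RatFunc.algebraMap_ne_zero x.denom_ne_zero
  rw [← RatFunc.num_div_denom x, div_pow, ← div_self (pow_ne_zero 2 h1), ← add_div,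
    div_eq_zero_iff, or_iff_left (pow_ne_zero 2 h1), ← map_pow, ← map_pow, ← map_add,
    map_eq_zero_iff _ (RatFunc.algebraMap_injective ℝ), add_comm] at h
  exact Polynomial.eval_sq_add_sq_ne_zero (RatFunc.isCoprime_num_denom x) 0 (by simp [h])

theorem DressD.C_mem (r : ℝ) : RatFunc.C r ∈ DressD := by
  have unit_interval : ∀ r : ℝ, 0 < r → r ≤ 1 → RatFunc.C r ∈ DressD := by
    intro r h0 h1
    have h2 : (1 + (RatFunc.C (√(r⁻¹ - 1))) ^ 2)⁻¹ = RatFunc.C r := by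
      have : 0 ≤ r⁻¹ - 1 := by
        have := (one_le_inv₀ h0).mpr h1
        linarith
      rw [← map_pow, Real.sq_sqrt this, ← map_one RatFunc.C, ← map_add, ← map_inv₀]
      simp
    rw [← h2]
    exact inv_one_add_sq_mem _
  have pos : ∀ r : ℝ, 0 < r → RatFunc.C r ∈ DressD := by
    intro r h0
    obtain ⟨n, hn⟩ := exists_nat_gt r
    have hn0 : (0 : ℝ) < n := h0.trans hn
    have h : RatFunc.C r = (n : RatFunc ℝ) * RatFunc.C (r / n) := by
      rw [← map_natCast RatFunc.C n, ← map_mul, mul_div_cancel₀ _ hn0.ne']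
    rw [h]
    exact mul_mem (natCast_mem _ n)
      (unit_interval _ (by positivity) ((div_le_one hn0).mpr hn.le))
  rcases lt_trichotomy r 0 with h | h | h
  · have := neg_mem (pos (-r) (by linarith))
    rwa [map_neg, neg_neg] at this
  · simp [h, zero_mem]
  · exact pos r h

theorem DressD.div_one_add_sq_mem (x : RatFunc ℝ) : x / (1 + x ^ 2) ∈ DressD := by
  have half : (2⁻¹ : RatFunc ℝ) ∈ DressD := by
    have := C_mem (2⁻¹)
    rwa [map_inv₀, map_ofNat] at this
  have hx := RatFunc.one_add_sq_ne_zero x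
  by_cases h : 1 + x = 0
  · have : x = -1 := by linear_combination h
    subst this
    have : (-1 : RatFunc ℝ) / (1 + (-1) ^ 2) = -(2⁻¹) := by norm_num
    rw [this]
    exact neg_mem half
  · have h2 : x / (1 + x ^ 2) = (1 + ((1 - x) / (1 + x)) ^ 2)⁻¹ - 2⁻¹ := by
      have : 1 + ((1 - x) / (1 + x)) ^ 2 = 2 * (1 + x ^ 2) / (1 + x) ^ 2 := by
        field_simp
        ring
      rw [this]
      field_simp
      ring
    rw [h2]
    exact sub_mem (inv_one_add_sq_mem _) half

open Polynomial in
/-- A linear polynomial divided by a quadratic one without real roots lies in the Dress ring. -/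
theorem DressD.linear_div_quadratic_mem (a b α β : ℝ) (hβ : β ≠ 0) :
    algebraMap ℝ[X] (RatFunc ℝ) (C a * X + C b) /
      algebraMap ℝ[X] (RatFunc ℝ) ((X - C α) ^ 2 + C β ^ 2) ∈ DressD := by
  set x : RatFunc ℝ := (RatFunc.X - RatFunc.C α) / RatFunc.C β with hx
  have hβ' : RatFunc.C β ≠ 0 := by simpa using hβ
  have h1 := RatFunc.one_add_sq_ne_zero x
  have hX : RatFunc.X = RatFunc.C β * x + RatFunc.C α := by
    rw [hx]; field_simp; ring
  have key : algebraMap ℝ[X] (RatFunc ℝ) (C a * X + C b) /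
      algebraMap ℝ[X] (RatFunc ℝ) ((X - C α) ^ 2 + C β ^ 2) =
      RatFunc.C (a / β) * (x / (1 + x ^ 2)) +
        RatFunc.C ((a * α + b) / β ^ 2) * (1 + x ^ 2)⁻¹ := by
    simp only [map_add, map_mul, map_pow, map_sub, map_div₀, RatFunc.algebraMap_C,
      RatFunc.algebraMap_X]
    have h2 : (RatFunc.X - RatFunc.C α) ^ 2 + RatFunc.C β ^ 2 =
        RatFunc.C β ^ 2 * (1 + x ^ 2) := by rw [hX]; ring
    rw [h2, hX]
    field_simp
    ring
  rw [key]
  exact add_mem (mul_mem (C_mem _) (div_one_add_sq_mem _))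
    (mul_mem (C_mem _) (inv_one_add_sq_mem _))

open Polynomial in
/-- A fraction of nonpositive degree whose denominator has no real root lies in the
Dress ring. -/
theorem DressD.div_mem (f h : ℝ[X]) (hh : ∀ u, h.eval u ≠ 0)
    (hd : f.natDegree ≤ h.natDegree) :
    algebraMap ℝ[X] (RatFunc ℝ) f / algebraMap ℝ[X] (RatFunc ℝ) h ∈ DressD := by
  induction hn : h.natDegree using Nat.strong_induction_on generalizing f h with
  | _ n ih =>
  have h0 : h ≠ 0 := by
    rintro rfl
    exact hh 0 (by simp)
  rcases Nat.eq_zero_or_pos n with hn0 | hn0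
  · rw [eq_C_of_natDegree_eq_zero (hn.trans hn0),
      eq_C_of_natDegree_eq_zero (p := f) (by omega), RatFunc.algebraMap_C,
      RatFunc.algebraMap_C, ← map_div₀]
    exact C_mem _
  obtain ⟨z, hz⟩ : ∃ z : ℂ, aeval z h = 0 := by
    apply IsAlgClosed.exists_aeval_eq_zero
    exact (natDegree_pos_iff_degree_pos.mp (hn ▸ hn0)).ne'
  have him : z.im ≠ 0 := by
    intro him
    have hz' : z = ((z.re : ℝ) : ℂ) := Complex.ext rfl (by simpa using him)
    apply hh z.re
    rw [hz', ← Complex.coe_algebraMap, aeval_algebraMap_apply] at hz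
    simpa using hz
  obtain ⟨k, hk⟩ := h.quadratic_dvd_of_aeval_eq_zero_im_ne_zero hz him
  set Q : ℝ[X] := (X - C z.re) ^ 2 + C z.im ^ 2 with hQ
  have hQ' : X ^ 2 - C (2 * z.re) * X + C (‖z‖ ^ 2) = Q := by
    rw [hQ, ← Complex.normSq_eq_norm_sq, Complex.normSq_apply]
    simp only [map_add, map_mul, map_ofNat]
    ring
  rw [hQ'] at hk
  have hQd : Q.natDegree = 2 := by rw [hQ]; compute_degree!
  have hQm : Q.Monic := by
    rw [← hQ']; monicity!
  have hk0 : k ≠ 0 := by rintro rfl; simp [h0] at hk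
  have hkd : h.natDegree = 2 + k.natDegree := by
    rw [hk, natDegree_mul hQm.ne_zero hk0, hQd]
  have hkr : ∀ u, k.eval u ≠ 0 := fun u hu => hh u (by rw [hk, eval_mul, hu, mul_zero])
  have hdiv := modByMonic_add_div f Q
  obtain ⟨a, b, hab⟩ : ∃ a b, f %ₘ Q = C a * X + C b := by
    apply exists_eq_X_add_C_of_natDegree_le_one
    have := natDegree_modByMonic_lt f hQm (by rintro h1; simp [h1] at hQd)
    omega
  have h1 := ih k.natDegree (by omega) (f /ₘ Q) k hkr
    (by rw [natDegree_divByMonic f hQm]; omega) rfl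
  have h2 := ih k.natDegree (by omega) 1 k hkr (by simp) rfl
  have h3 := linear_div_quadratic_mem a b z.re z.im him
  have hQa : algebraMap ℝ[X] (RatFunc ℝ) Q ≠ 0 := RatFunc.algebraMap_ne_zero hQm.ne_zero
  have hka : algebraMap ℝ[X] (RatFunc ℝ) k ≠ 0 := RatFunc.algebraMap_ne_zero hk0
  have key : algebraMap ℝ[X] (RatFunc ℝ) f / algebraMap ℝ[X] (RatFunc ℝ) h =
      algebraMap ℝ[X] (RatFunc ℝ) (C a * X + C b) / algebraMap ℝ[X] (RatFunc ℝ) Q *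
        (algebraMap ℝ[X] (RatFunc ℝ) 1 / algebraMap ℝ[X] (RatFunc ℝ) k) +
      algebraMap ℝ[X] (RatFunc ℝ) (f /ₘ Q) / algebraMap ℝ[X] (RatFunc ℝ) k := by
    rw [← hab, hk]
    conv_lhs => rw [← hdiv]
    rw [map_add, map_mul, map_mul, map_one]
    field_simp
  rw [key]
  exact add_mem (mul_mem h3 h2) h1

open Filter Topology in
/-- If `F` is positive where the nonnegative function `G` vanishes, then `F + t G` is positive
on a given compact set for all large `t`. -/
theorem IsCompact.eventually_forall_add_mul_pos {α : Type*} [TopologicalSpace α] {K : Set α}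
    (hK : IsCompact K) {F G : α → ℝ} (hF : Continuous F) (hG : Continuous G)
    (hG0 : ∀ x, 0 ≤ G x) (hFG : ∀ x, G x = 0 → 0 < F x) :
    ∀ᶠ t : ℝ in atTop, ∀ x ∈ K, 0 < F x + t * G x := by
  refine hK.induction_on (p := fun K => ∀ᶠ t : ℝ in atTop, ∀ x ∈ K, 0 < F x + t * G x)
    (by simp) (fun s t hst ht => ht.mono fun _ h x hx => h x (hst hx)) ?_ fun x hx => ?_
  · intro s t hs ht
    filter_upwards [hs, ht] with r h1 h2 x hx
    exact hx.elim (h1 x) (h2 x)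
  · obtain ⟨T, hT⟩ : ∃ T : ℝ, 0 < F x + T * G x := by
      rcases (hG0 x).eq_or_lt with h | h
      · exact ⟨0, by simpa using hFG x h.symm⟩
      · refine ⟨(|F x| + 1) / G x, ?_⟩
        rw [div_mul_cancel₀ _ h.ne']
        linarith [neg_abs_le (F x)]
    have hc : Continuous fun y => F y + T * G y := by fun_prop
    refine ⟨{y | 0 < F y + T * G y},
      mem_nhdsWithin_of_mem_nhds ((isOpen_lt continuous_const hc).mem_nhds hT), ?_⟩
    filter_upwards [eventually_ge_atTop T] with t ht y hy
    have := mul_le_mul_of_nonneg_right ht (hG0 y)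
    have hy : 0 < F y + T * G y := hy
    linarith

open Filter Polynomial in
theorem Polynomial.exists_forall_ge_eval_add_mul_pos {F G : ℝ[X]}
    (hG0 : ∀ x, 0 ≤ G.eval x) (hG : G ≠ 0) (hd : F.natDegree ≤ G.natDegree) :
    ∃ R T : ℝ, ∀ t ≥ T, ∀ x ≥ R, 0 < F.eval x + t * G.eval x := by
  obtain ⟨c, hc⟩ := (isBigO_atTop_of_degree_le F G
    (by
      rw [degree_eq_natDegree hG]
      exact degree_le_of_natDegree_le hd)).bound
  have hr : ∀ᶠ x in atTop, ¬ G.IsRoot x := eventually_atTop_not_isRoot G hG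
  obtain ⟨R, hR⟩ := eventually_atTop.mp (hc.and hr)
  refine ⟨R, c + 1, fun t ht x hx => ?_⟩
  obtain ⟨h1, h2⟩ := hR x hx
  rw [Real.norm_eq_abs, Real.norm_of_nonneg (hG0 x)] at h1
  have h3 : 0 < G.eval x := lt_of_le_of_ne (hG0 x) (Ne.symm h2)
  nlinarith [neg_abs_le (F.eval x), mul_le_mul_of_nonneg_right ht h3.le]

open Filter Polynomial in
/-- If `F` is positive at the roots of the nonnegative polynomial `G` and `deg F ≤ deg G`, then
`F + t G` is positive on the whole line for all large `t`. -/
theorem Polynomial.eventually_forall_eval_add_mul_pos {F G : ℝ[X]}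
    (hG0 : ∀ x, 0 ≤ G.eval x) (hG : G ≠ 0) (hd : F.natDegree ≤ G.natDegree)
    (hFG : ∀ x, G.eval x = 0 → 0 < F.eval x) :
    ∀ᶠ t : ℝ in atTop, ∀ x, 0 < F.eval x + t * G.eval x := by
  obtain ⟨R, T, h1⟩ := exists_forall_ge_eval_add_mul_pos hG0 hG hd
  obtain ⟨R', T', h2⟩ := exists_forall_ge_eval_add_mul_pos (F := F.comp (-X))
    (G := G.comp (-X)) (fun x => by simpa using hG0 (-x)) (by simpa [comp_eq_zero_iff] using hG)
    (by simpa [natDegree_comp] using hd)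
  filter_upwards [eventually_ge_atTop T, eventually_ge_atTop T',
    (isCompact_Icc (a := -R') (b := R)).eventually_forall_add_mul_pos F.continuous
      G.continuous hG0 hFG] with t ht ht' hK x
  rcases le_total R x with hx | hx
  · exact h1 t ht x hx
  rcases le_total x (-R') with hx' | hx'
  · simpa using h2 t ht' (-x) (by linarith)
  · exact hK x ⟨hx', hx⟩

theorem IsProductOfIdempotents.mul {R : Type*} [CommRing R] {A B : Matrix (Fin 2) (Fin 2) R}
    (hA : IsProductOfIdempotents A) (hB : IsProductOfIdempotents B) :
    IsProductOfIdempotents (A * B) := by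
  obtain ⟨L, hL, rfl⟩ := hA
  obtain ⟨M, hM, rfl⟩ := hB
  refine ⟨L ++ M, fun T hT => ?_, List.prod_append⟩
  exact (List.mem_append.mp hT).elim (hL T) (hM T)

theorem IsIdempotentElem.isProductOfIdempotents {R : Type*} [CommRing R]
    {A : Matrix (Fin 2) (Fin 2) R} (hA : IsIdempotentElem A) : IsProductOfIdempotents A :=
  ⟨[A], by simpa using hA, by simp⟩

theorem isProductOfIdempotents_single {R : Type*} [CommRing R] (s : R) :
    IsProductOfIdempotents !![s, 0; 0, 0] := by
  have h : !![s, 0; 0, 0] = !![1, 1; 0, 0] * !![1, 0; s - 1, 0] := by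
    simp
  rw [h]
  refine .mul (IsIdempotentElem.isProductOfIdempotents ?_)
    (IsIdempotentElem.isProductOfIdempotents ?_) <;>
  · ext i j
    fin_cases i <;> fin_cases j <;> simp [Matrix.mul_apply]

theorem isProductOfIdempotents_of_mul_eq {R : Type*} [CommRing R] (s a b c : R)
    (h : a * (1 - a) = b * c) : IsProductOfIdempotents !![s * a, s * b; 0, 0] := by
  have hs : !![s * a, s * b; 0, 0] = !![s, 0; 0, 0] * !![a, b; c, 1 - a] := by
    simp
  rw [hs]
  refine (isProductOfIdempotents_single s).mul (IsIdempotentElem.isProductOfIdempotents ?_)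
  ext i j
  fin_cases i <;> fin_cases j <;> simp [Matrix.mul_apply]
  · linear_combination -h
  · ring
  · ring
  · linear_combination -h

open Polynomial in
theorem isProductOfIdempotents_of_eq_div (p q : DressD) (f g γ : ℝ[X]) (hγ : ∀ u, γ.eval u ≠ 0)
    (hγe : Even γ.natDegree) (hg : g ≠ 0) (hfg : f.natDegree ≤ g.natDegree)
    (hgγ : g.natDegree ≤ γ.natDegree) (hpos : ∀ u, g.eval u = 0 → 0 < f.eval u)
    (hp : (p : RatFunc ℝ) = algebraMap ℝ[X] (RatFunc ℝ) f / algebraMap ℝ[X] (RatFunc ℝ) γ)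
    (hq : (q : RatFunc ℝ) = algebraMap ℝ[X] (RatFunc ℝ) g / algebraMap ℝ[X] (RatFunc ℝ) γ) :
    IsProductOfIdempotents !![p, q; 0, 0] := by
  set d := g.natDegree with hd
  set η : ℝ[X] := (X ^ 2 + 1) ^ (d / 2) with hη
  have hηd : η.natDegree = 2 * (d / 2) := by
    rw [hη, natDegree_pow, show (X ^ 2 + 1 : ℝ[X]).natDegree = 2 by compute_degree!]
    ring
  have hη0 : ∀ u, 0 < η.eval u := fun u => by
    simp only [hη, eval_pow, eval_add, eval_X, eval_one]
    positivity
  have hηn : η ≠ 0 := by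
    intro h
    simpa [h] using hη0 0
  have hγn : γ ≠ 0 := by
    rintro rfl
    exact hγ 0 (by simp)
  have hG2 : (g ^ 2).natDegree = 2 * d := natDegree_pow g 2
  have hFd : (f * η).natDegree ≤ d + 2 * (d / 2) := natDegree_mul_le.trans (by omega)
  have hlc : 0 < (g ^ 2).coeff (2 * d) := by
    have := leadingCoeff_ne_zero.mpr hg
    rw [← hG2, coeff_natDegree, leadingCoeff_pow]
    positivity
  obtain ⟨t, ht, htc⟩ := ((eventually_forall_eval_add_mul_pos (F := f * η) (G := g ^ 2)
    (fun x => by simpa using sq_nonneg _) (pow_ne_zero 2 hg) (by omega)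
    (fun x hx => by
      rw [eval_mul]
      exact mul_pos (hpos x (by simpa using hx)) (hη0 x))).and
    (Filter.eventually_gt_atTop (-(f * η).coeff (2 * d) / (g ^ 2).coeff (2 * d)))).exists
  set h : ℝ[X] := f * η + C t * g ^ 2 with hh
  have hh0 : ∀ u, h.eval u ≠ 0 := fun u => by
    have := ht u
    rw [hh, eval_add, eval_mul (p := C t), eval_C]
    exact this.ne'
  have hhd : h.natDegree = 2 * d := by
    apply le_antisymm
    · exact (natDegree_add_le _ _).trans
        (max_le (by omega) ((natDegree_C_mul_le _ _).trans hG2.le))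
    · apply le_natDegree_of_ne_zero
      rw [hh, coeff_add, coeff_C_mul]
      rw [div_lt_iff₀ hlc] at htc
      linarith
  have hhn : h ≠ 0 := by
    intro h'
    simpa [h'] using hh0 0
  have ha := DressD.div_mem (f * η) h hh0 (by omega)
  have hb := DressD.div_mem (g * η) h hh0 (natDegree_mul_le.trans (by omega))
  have hc := DressD.div_mem (C t * (g * f)) h hh0
    ((natDegree_C_mul_le _ _).trans (natDegree_mul_le.trans (by omega)))
  have hs := DressD.div_mem h (γ * η) (fun u => by simpa using ⟨hγ u, (hη0 u).ne'⟩) (by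
    rw [natDegree_mul hγn hηn, hηd]
    obtain ⟨m, hm⟩ := hγe
    omega)
  have hηa : algebraMap ℝ[X] (RatFunc ℝ) η ≠ 0 := RatFunc.algebraMap_ne_zero hηn
  have hγa : algebraMap ℝ[X] (RatFunc ℝ) γ ≠ 0 := RatFunc.algebraMap_ne_zero hγn
  have hha : algebraMap ℝ[X] (RatFunc ℝ) h ≠ 0 := RatFunc.algebraMap_ne_zero hhn
  convert isProductOfIdempotents_of_mul_eq (⟨_, hs⟩ : DressD) ⟨_, ha⟩ ⟨_, hb⟩ ⟨_, hc⟩ ?_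
    using 4
  · apply Subtype.ext
    simp only [hp, Subring.coe_mul, map_mul]
    field_simp
  · congr 1
    apply Subtype.ext
    simp only [hq, Subring.coe_mul, map_mul]
    field_simp
  · apply Subtype.ext
    have h1 : algebraMap ℝ[X] (RatFunc ℝ) h = algebraMap ℝ[X] (RatFunc ℝ) f *
        algebraMap ℝ[X] (RatFunc ℝ) η + algebraMap ℝ[X] (RatFunc ℝ) (C t) *
        algebraMap ℝ[X] (RatFunc ℝ) g ^ 2 := by rw [hh]; simp only [map_add, map_mul, map_pow]
    simp only [Subring.coe_mul, AddSubgroupClass.coe_sub, Subring.coe_one, map_mul]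
    field_simp
    rw [h1]
    ring

open Polynomial in
theorem evalD_eq_div (p : DressD) (f γ : ℝ[X]) (hγ : ∀ u, γ.eval u ≠ 0)
    (hp : (p : RatFunc ℝ) = algebraMap ℝ[X] (RatFunc ℝ) f / algebraMap ℝ[X] (RatFunc ℝ) γ)
    (u : ℝ) : evalD p u = f.eval u / γ.eval u := by
  have hγn : γ ≠ 0 := by
    rintro rfl
    exact hγ 0 (by simp)
  have hden : (p : RatFunc ℝ).denom.eval u ≠ 0 := by
    obtain ⟨k, hk⟩ : (p : RatFunc ℝ).denom ∣ γ := hp ▸ RatFunc.denom_div_dvd f γ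
    intro h
    exact hγ u (by rw [hk, eval_mul, h, zero_mul])
  have hcross : (p : RatFunc ℝ).num * γ = f * (p : RatFunc ℝ).denom := by
    apply RatFunc.algebraMap_injective ℝ
    rw [← RatFunc.num_div_denom (p : RatFunc ℝ), div_eq_div_iff
      (RatFunc.algebraMap_ne_zero (RatFunc.denom_ne_zero _))
      (RatFunc.algebraMap_ne_zero hγn)] at hp
    simpa only [map_mul] using hp
  have := congrArg (eval u) hcross
  rw [eval_mul, eval_mul] at this
  rw [evalD, RatFunc.eval, eval₂_id, eval₂_id, div_eq_div_iff hden (hγ u), this]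

open Polynomial in
/-- Two elements of the Dress ring have a common positive denominator of even degree. -/
theorem DressD.exists_common_denom (p q : DressD) : ∃ f g γ : ℝ[X], (∀ u, 0 < γ.eval u) ∧
    Even γ.natDegree ∧ g.natDegree ≤ γ.natDegree ∧
    (p : RatFunc ℝ) = algebraMap ℝ[X] (RatFunc ℝ) f / algebraMap ℝ[X] (RatFunc ℝ) γ ∧
    (q : RatFunc ℝ) = algebraMap ℝ[X] (RatFunc ℝ) g / algebraMap ℝ[X] (RatFunc ℝ) γ := by
  obtain ⟨f, γ, hγ, -, hp⟩ := exists_eq_div p.2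
  obtain ⟨g, δ, hδ, hd, hq⟩ := exists_eq_div q.2
  have hγ0 : γ ≠ 0 := by
    rintro rfl
    exact hγ 0 (by simp)
  have hδ0 : δ ≠ 0 := by
    rintro rfl
    exact hδ 0 (by simp)
  have hγa : algebraMap ℝ[X] (RatFunc ℝ) γ ≠ 0 := RatFunc.algebraMap_ne_zero hγ0
  have hδa : algebraMap ℝ[X] (RatFunc ℝ) δ ≠ 0 := RatFunc.algebraMap_ne_zero hδ0
  refine ⟨f * δ * (γ * δ), g * γ * (γ * δ), (γ * δ) ^ 2, fun u => ?_, ?_, ?_, ?_, ?_⟩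
  · have h1 := hγ u
    have h2 := hδ u
    simp only [eval_pow, eval_mul]
    positivity
  · rw [natDegree_pow]
    exact even_two_mul _
  · rw [natDegree_pow, natDegree_mul hγ0 hδ0]
    refine natDegree_mul_le.trans ?_
    rw [natDegree_mul hγ0 hδ0]
    have := natDegree_mul_le (p := g) (q := γ)
    omega
  · rw [hp]
    simp only [map_mul, map_pow]
    field_simp
  · rw [hq]
    simp only [map_mul, map_pow]
    field_simp

theorem stmt_5 (p q : DressD)
    (hdeg : RatFunc.intDegree (p : RatFunc ℝ) ≤ RatFunc.intDegree (q : RatFunc ℝ))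
    (hsign : (∀ z : ℝ, evalD q z = 0 → 0 < evalD p z) ∨
             (∀ z : ℝ, evalD q z = 0 → evalD p z < 0)) :
    IsProductOfIdempotents (!![p, q; 0, 0] : Matrix (Fin 2) (Fin 2) DressD) := by
  obtain ⟨f, g, γ, hγ, hγe, hgγ, hp, hq⟩ := DressD.exists_common_denom p q
  have hγn : γ ≠ 0 := by
    rintro rfl
    simpa using hγ 0
  have hγa : algebraMap (Polynomial ℝ) (RatFunc ℝ) γ ≠ 0 := RatFunc.algebraMap_ne_zero hγn
  by_cases hg : g = 0
  · have hq0 : q = 0 := Subtype.ext (by simp [hq, hg])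
    rw [hq0]
    exact isProductOfIdempotents_single p
  have hga : algebraMap (Polynomial ℝ) (RatFunc ℝ) g ≠ 0 := RatFunc.algebraMap_ne_zero hg
  have hfg : f.natDegree ≤ g.natDegree := by
    by_cases hf : f = 0
    · simp [hf]
    have hfa : algebraMap (Polynomial ℝ) (RatFunc ℝ) f ≠ 0 := RatFunc.algebraMap_ne_zero hf
    rw [hp, hq, RatFunc.intDegree_div hfa hγa, RatFunc.intDegree_div hga hγa] at hdeg
    simp only [RatFunc.intDegree_polynomial] at hdeg
    omega
  have hγ0 : ∀ u, γ.eval u ≠ 0 := fun u => (hγ u).ne'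
  simp only [evalD_eq_div p f γ hγ0 hp, evalD_eq_div q g γ hγ0 hq] at hsign
  rcases hsign with h | h
  · refine isProductOfIdempotents_of_eq_div p q f g γ hγ0 hγe hg hfg hgγ (fun u hu => ?_) hp hq
    exact (div_pos_iff_of_pos_right (hγ u)).mp (h u (by simp [hu]))
  · refine isProductOfIdempotents_of_eq_div p q (-f) (-g) (-γ) (by simpa using hγ0)
      (by simpa using hγe) (neg_ne_zero.mpr hg) (by simpa using hfg) (by simpa using hgγ)
      (fun u hu => ?_) (by simpa [neg_div_neg_eq] using hp) (by simpa [neg_div_neg_eq] using hq)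
    have := h u (by simp [neg_eq_zero.mp (by simpa using hu : -g.eval u = 0)])
    rw [div_neg_iff] at this
    have h2 := hγ u
    rw [Polynomial.eval_neg]
    rcases this with h | h
    · linarith
    · linarith
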